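/- The linear order ω·ω* (the lexicographic order on ℕᵒᵈ × ℕ, where ℕᵒᵈ is ℕ with reversed order) is indecomposable, and the linear order ω*·ω (the lexicographic order on ℕ × ℕᵒᵈ) is indecomposable. -/

import Mathlib

/-- A linear order `L` is *indecomposable* if for every partition of `L` into
two sets, at least one of the two sets contains a copy of `L` (the range of an
order embedding of `L` into that set with its induced order). -/
def Indecomposable' (L : Type*) [LinearOrder L] : Prop :=
  ∀ A B : Set L, A ∪ B = Set.univ →
    Nonempty (L ↪o A) ∨ Nonempty (L ↪o B)

/-- The natural numbers, of order type `ω`, are indecomposable. -/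
theorem indecomposable'_nat : Indecomposable' ℕ := by
  intro A B h
  obtain ⟨g, hg | hg⟩ := Nat.exists_subseq_of_forall_mem_union (s := A) (t := B) id
    fun n => h ▸ Set.mem_univ n
  · exact .inl ⟨OrderEmbedding.ofMapLEIff (fun n => (⟨g n, hg n⟩ : A)) fun _ _ => g.le_iff_le⟩
  · exact .inr ⟨OrderEmbedding.ofMapLEIff (fun n => (⟨g n, hg n⟩ : B)) fun _ _ => g.le_iff_le⟩

/-- The order dual of an indecomposable linear order is indecomposable. -/
theorem Indecomposable'.orderDual {L : Type*} [LinearOrder L] (hL : Indecomposable' L) :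
    Indecomposable' Lᵒᵈ := by
  intro A B h
  refine (hL (OrderDual.toDual ⁻¹' A) (OrderDual.toDual ⁻¹' B) ?_).imp ?_ ?_
  · rw [← Set.preimage_union, h, Set.preimage_univ]
  · rintro ⟨f⟩
    exact ⟨OrderEmbedding.ofMapLEIff
      (fun x => (⟨OrderDual.toDual (f (OrderDual.ofDual x)).1, (f _).2⟩ : A))
      fun _ _ => f.le_iff_le⟩
  · rintro ⟨f⟩
    exact ⟨OrderEmbedding.ofMapLEIff
      (fun x => (⟨OrderDual.toDual (f (OrderDual.ofDual x)).1, (f _).2⟩ : B))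
      fun _ _ => f.le_iff_le⟩

/-- If `α` embeds into the set of indices at which the fibre of `S` contains a copy of `β`,
then `S` contains a copy of the lexicographic product `α ×ₗ β`. -/
theorem nonempty_lex_orderEmbedding_of_fibers {α β : Type*} [LinearOrder α] [LinearOrder β]
    {S : Set (α ×ₗ β)} (f : α ↪o {a : α | Nonempty (β ↪o {b : β | toLex (a, b) ∈ S})}) :
    Nonempty (α ×ₗ β ↪o S) := by
  have g (a : α) : β ↪o {b : β | toLex ((f a).1, b) ∈ S} := Classical.choice (f a).2
  refine ⟨OrderEmbedding.ofStrictMono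
    (fun x => ⟨toLex ((f (ofLex x).1).1, (g (ofLex x).1 (ofLex x).2).1), (g _ _).2⟩) ?_⟩
  rintro ⟨a, b⟩ ⟨c, d⟩ h
  rw [← Subtype.coe_lt_coe, Prod.Lex.toLex_lt_toLex]
  rcases Prod.Lex.toLex_lt_toLex.1 h with h | ⟨h, hbd⟩
  · exact .inl (f.lt_iff_lt.2 h)
  · obtain rfl : a = c := h
    exact .inr ⟨rfl, (g a).lt_iff_lt.2 hbd⟩

/-- The lexicographic product of two indecomposable linear orders is indecomposable. -/
theorem Indecomposable'.lex {α β : Type*} [LinearOrder α] [LinearOrder β]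
    (hα : Indecomposable' α) (hβ : Indecomposable' β) : Indecomposable' (α ×ₗ β) := by
  intro A B h
  refine (hα {a | Nonempty (β ↪o {b : β | toLex (a, b) ∈ A})}
    {a | Nonempty (β ↪o {b : β | toLex (a, b) ∈ B})} ?_).imp ?_ ?_
  · refine Set.eq_univ_of_forall fun a => hβ _ _ (Set.eq_univ_of_forall fun b => ?_)
    exact (h ▸ Set.mem_univ (toLex (a, b)) : toLex (a, b) ∈ A ∪ B)
  · exact fun ⟨f⟩ => nonempty_lex_orderEmbedding_of_fibers f
  · exact fun ⟨f⟩ => nonempty_lex_orderEmbedding_of_fibers f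

/-- `ω·ω*` (the lexicographic order on `ℕᵒᵈ × ℕ`) and `ω*·ω` (the lexicographic
order on `ℕ × ℕᵒᵈ`) are both indecomposable. -/
theorem indecomposable_omega_mul_omegaStar_and_omegaStar_mul_omega :
    Indecomposable' (ℕᵒᵈ ×ₗ ℕ) ∧ Indecomposable' (ℕ ×ₗ ℕᵒᵈ) :=
  ⟨indecomposable'_nat.orderDual.lex indecomposable'_nat,
    indecomposable'_nat.lex indecomposable'_nat.orderDual⟩
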